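/- For every real s, e^{5s} + 5(6s − 25)e^{4s} + 10(33s − 35)e^{3s} + 10(33s + 35)e^{2s} + 5(6s + 25)e^{s} − 1 = ∑_{k=7}^∞ [5^k + (110k − 350)·3^k + 5(3k − 50)·2^{2k−1} + (165k + 350)·2^{k} + 30k + 125] · s^k / k!; in particular, the coefficients of s^k in the Maclaurin expansion of the left-hand side vanish for 0 ≤ k ≤ 6. -/

import Mathlib

open Real

/-- The coefficient `5^k + (110k−350)·3^k + 5(3k−50)·2^{2k−1} + (165k+350)·2^k + 30k + 125`. -/
noncomputable def coeff (k : ℕ) : ℝ :=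
  5 ^ k + (110 * (k : ℝ) - 350) * 3 ^ k + 5 * (3 * (k : ℝ) - 50) * 2 ^ (2 * k - 1)
    + (165 * (k : ℝ) + 350) * 2 ^ k + 30 * (k : ℝ) + 125

/-- `F(s) = e^{5s} + 5(6s−25)e^{4s} + 10(33s−35)e^{3s} + 10(33s+35)e^{2s} + 5(6s+25)eˢ − 1`. -/
noncomputable def Ffun (s : ℝ) : ℝ :=
  Real.exp (5 * s) + 5 * (6 * s - 25) * Real.exp (4 * s)
    + 10 * (33 * s - 35) * Real.exp (3 * s) + 10 * (33 * s + 35) * Real.exp (2 * s)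
    + 5 * (6 * s + 25) * Real.exp s - 1

/-- The `k`-th Maclaurin coefficient of `(p * s + q) * exp (a * s)`, multiplied by `k!`. -/
noncomputable def linExpCoeff (p q a : ℝ) (k : ℕ) : ℝ :=
  a ^ k * q + k * a ^ (k - 1) * p

theorem hasSum_linear_mul_exp (p q a s : ℝ) :
    HasSum (fun k : ℕ => linExpCoeff p q a k * s ^ k / k.factorial)
      ((p * s + q) * Real.exp (a * s)) := by
  have hexp : HasSum (fun k : ℕ => (a * s) ^ k / k.factorial) (Real.exp (a * s)) := by
    rw [Real.exp_eq_exp_ℝ]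
    exact NormedSpace.expSeries_div_hasSum_exp (a * s)
  have hlin : HasSum (fun k : ℕ => k * a ^ (k - 1) * p * s ^ k / k.factorial)
      (p * s * Real.exp (a * s)) := by
    rw [← hasSum_nat_add_iff' 1]
    simp only [Finset.sum_range_one, Nat.cast_zero, zero_mul, zero_div, sub_zero]
    refine (hexp.mul_left (p * s)).congr_fun fun k => ?_
    rw [Nat.add_sub_cancel, Nat.factorial_succ]
    push_cast
    field_simp
    ring
  rw [add_mul, add_comm]
  refine ((hexp.mul_left q).add hlin).congr_fun fun k => ?_
  rw [linExpCoeff]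
  ring

theorem iteratedDeriv_linear_mul_exp (p q a : ℝ) (k : ℕ) :
    iteratedDeriv k (fun s => (p * s + q) * Real.exp (a * s)) =
      fun s => (a ^ k * (p * s + q) + k * a ^ (k - 1) * p) * Real.exp (a * s) := by
  induction k with
  | zero => simp
  | succ k ih =>
    rw [iteratedDeriv_succ, ih]
    funext s
    have hexp : HasDerivAt (fun s => Real.exp (a * s)) (Real.exp (a * s) * (a * 1)) s :=
      ((hasDerivAt_id s).const_mul a).exp
    have hlin : HasDerivAt (fun s => a ^ k * (p * s + q) + k * a ^ (k - 1) * p)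
        (a ^ k * (p * 1)) s :=
      ((((hasDerivAt_id s).const_mul p).add_const q).const_mul (a ^ k)).add_const _
    refine (hlin.mul hexp).deriv.trans ?_
    rcases k with _ | k
    · simp
      ring
    · simp only [Nat.add_sub_cancel]
      push_cast
      ring

theorem Ffun_eq_sum :
    Ffun = fun s => ∑ i : Fin 6, ((![0, 30, 330, 330, 30, 0] : Fin 6 → ℝ) i * s +
      (![-1, 125, 350, -350, -125, 1] : Fin 6 → ℝ) i) * Real.exp ((i : ℕ) * s) := by
  funext s
  simp [Ffun, Fin.sum_univ_succ]
  ring_nf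

/-- The `k`-th Maclaurin coefficient of `Ffun`, multiplied by `k!`. -/
noncomputable def FfunCoeff (k : ℕ) : ℝ :=
  ∑ i : Fin 6, linExpCoeff ((![0, 30, 330, 330, 30, 0] : Fin 6 → ℝ) i)
    ((![-1, 125, 350, -350, -125, 1] : Fin 6 → ℝ) i) (i : ℕ) k

theorem FfunCoeff_eq_zero {k : ℕ} (hk : k ≤ 6) : FfunCoeff k = 0 := by
  interval_cases k <;> norm_num [FfunCoeff, linExpCoeff, Fin.sum_univ_succ]

theorem FfunCoeff_eq_coeff {k : ℕ} (hk : 2 ≤ k) : FfunCoeff k = coeff k := by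
  obtain ⟨m, rfl⟩ := Nat.exists_eq_add_of_le' hk
  have h4 : (2 : ℝ) ^ (2 * (m + 2) - 1) = 8 * 4 ^ m := by
    rw [show 2 * (m + 2) - 1 = 2 * m + 3 by omega, pow_add, pow_mul]
    norm_num
    ring
  rw [coeff, h4]
  simp [FfunCoeff, linExpCoeff, Fin.sum_univ_succ]
  ring

theorem hasSum_Ffun (s : ℝ) :
    HasSum (fun k : ℕ => FfunCoeff k * s ^ k / k.factorial) (Ffun s) := by
  simp only [Ffun_eq_sum, FfunCoeff, Finset.sum_mul, Finset.sum_div]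
  exact hasSum_sum fun i _ => hasSum_linear_mul_exp _ _ _ s

theorem iteratedDeriv_Ffun_zero (k : ℕ) : iteratedDeriv k Ffun 0 = FfunCoeff k := by
  rw [Ffun_eq_sum, iteratedDeriv_fun_sum fun i _ => by fun_prop]
  simp [FfunCoeff, linExpCoeff, iteratedDeriv_linear_mul_exp]

/-- For every real `s`, `F(s) = ∑_{k=7}^∞ coeff k * s^k / k!`; in particular, the Maclaurin
coefficients of `F` of order `0 ≤ k ≤ 6` vanish. -/
theorem Ffun_eq_tsum :
    (∀ s : ℝ, Ffun s = ∑' k : ℕ, if 7 ≤ k then coeff k * s ^ k / (Nat.factorial k) else 0) ∧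
      ∀ k : ℕ, k ≤ 6 → iteratedDeriv k Ffun 0 = 0 := by
  refine ⟨fun s => ?_, fun k hk => (iteratedDeriv_Ffun_zero k).trans (FfunCoeff_eq_zero hk)⟩
  rw [← (hasSum_Ffun s).tsum_eq]
  refine tsum_congr fun k => ?_
  split_ifs with hk
  · rw [FfunCoeff_eq_coeff (by omega)]
  · rw [FfunCoeff_eq_zero (by omega), zero_mul, zero_div]
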